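/- Phase one of the ball-shuffling lower bound: there exist constants c₀, c₁, c₂ > 0 such that for all integers n ≥ 2 and all integers t with 1 ≤ t ≤ ⌊c₀·ln n⌋, the optimal ball-shuffling cost satisfies f_t(n) ≥ c₁·t·n^{1+c₂/t} − 2tn. -/

import Mathlib

/-- One shuffle step in the ball-shuffling problem with `t` bins:
a set `I` of bins is emptied, the new ball is added to the collected balls,
and the collected balls are redistributed among bins that are empty after the
collection (bins not in `I` that are nonempty keep their contents).
The cost is `(∑ i ∈ I, b i) + 1`. -/
def ShuffleStep (t : ℕ) (b b' : Fin t → ℕ) (c : ℕ) : Prop :=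
  ∃ I : Finset (Fin t),
    c = (∑ i ∈ I, b i) + 1 ∧
    (∀ i, i ∉ I → b i ≠ 0 → b' i = b i) ∧
    (∑ i, b' i) = (∑ i, b i) + 1

/-- An algorithm (run) for the ball-shuffling problem with `t` bins and `n` balls:
a sequence of configurations starting from all-empty bins, where the `k`-th step
is a valid shuffle of cost `c k`. -/
def IsRun (t n : ℕ) (b : ℕ → Fin t → ℕ) (c : ℕ → ℕ) : Prop :=
  (∀ i, b 0 i = 0) ∧ ∀ k, k < n → ShuffleStep t (b k) (b (k + 1)) (c k)

/-- `shuffleCost t n` is the minimum total cost of any algorithm for the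
ball-shuffling problem with `n` balls and `t` bins. -/
noncomputable def shuffleCost (t n : ℕ) : ℕ :=
  sInf { s | ∃ b c, IsRun t n b c ∧ s = ∑ k ∈ Finset.range n, c k }

/-- Starting from `j`, a position at least `b` can be reached by at most `h` jumps along `J`,
each of which increases the position. -/
def Reach (J : ℕ → ℕ → Prop) (b : ℕ) : ℕ → ℕ → Prop
  | 0, j => b ≤ j
  | h + 1, j => b ≤ j ∨ ∃ s, j < s ∧ J j s ∧ Reach J b h s

theorem Reach.of_le {J : ℕ → ℕ → Prop} {b j : ℕ} (hj : b ≤ j) (h : ℕ) : Reach J b h j := by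
  cases h with
  | zero => exact hj
  | succ h => exact Or.inl hj

/-- If no position in `[a, c)` has a jump to `b`, then the last jump on the way to `b` starts at
or after `c`, so `c` is reached with one jump less. -/
theorem Reach.pred {J : ℕ → ℕ → Prop}
    (hJ : ∀ τ s s', J τ s → τ < s' → s' ≤ s → J τ s') {a b c : ℕ} (hcb : c ≤ b)
    (hno : ∀ j, a ≤ j → j < c → ¬ J j b) :
    ∀ h j, a ≤ j → j < c → Reach J b (h + 1) j → Reach J c h j := by
  intro h
  induction h with
  | zero =>
    rintro j haj hjc (hb | ⟨s, hjs, hJs, hs⟩)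
    · exact hcb.trans hb
    · exact absurd (hJ j s b hJs (hjc.trans_le hcb) hs) (hno j haj hjc)
  | succ h ih =>
    rintro j haj hjc (hb | ⟨s, hjs, hJs, hs⟩)
    · exact Or.inl (hcb.trans hb)
    · refine Or.inr ⟨s, hjs, hJs, ?_⟩
      rcases lt_or_ge s c with hsc | hsc
      · exact ih s (haj.trans hjs.le) hsc hs
      · exact Reach.of_le hsc h

/-- A position from which `b` is reachable is followed by one with a direct jump to `b`. -/
theorem Reach.exists_jump {J : ℕ → ℕ → Prop}
    (hJ : ∀ τ s s', J τ s → τ < s' → s' ≤ s → J τ s') {b : ℕ} :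
    ∀ h j, j < b → Reach J b h j → ∃ c, j ≤ c ∧ c < b ∧ J c b := by
  intro h
  induction h with
  | zero => intro j hj hr; exact absurd hr (not_le.mpr hj)
  | succ h ih =>
    rintro j hj (hb | ⟨s, hjs, hJs, hs⟩)
    · exact absurd hb (not_le.mpr hj)
    · rcases lt_or_ge s b with hsb | hsb
      · obtain ⟨c, h₁, h₂, h₃⟩ := ih s hsb hs
        exact ⟨c, hjs.le.trans h₁, h₂, h₃⟩
      · exact ⟨j, le_rfl, hj, hJ j s b hJs hj hsb⟩

open Classical in
/-- If at most `k` positions jump across each point of the window `[a, b)`, then fewer than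
`(k + h).choose h` positions of the window reach its end by at most `h` jumps. -/
theorem card_reach_lt_choose {J : ℕ → ℕ → Prop}
    (hJ : ∀ τ s s', J τ s → τ < s' → s' ≤ s → J τ s') :
    ∀ N h k a b, h + k = N →
      (∀ s, a < s → s ≤ b → ((Finset.Ico a s).filter fun τ => J τ s).card ≤ k) →
      ((Finset.Ico a b).filter fun j => Reach J b h j).card + 1 ≤ (k + h).choose h := by
  intro N
  induction N with
  | zero =>
    intro h k a b hN _
    obtain rfl : h = 0 := by omega
    rw [Finset.filter_false_of_mem]
    · simp
    · intro j hj hr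
      exact absurd hr (not_le.mpr (Finset.mem_Ico.mp hj).2)
  | succ N ih =>
    intro h k a b hN hdepth
    by_cases hex : ∃ c, a ≤ c ∧ c < b ∧ J c b
    · obtain ⟨hac, hcb, hJc⟩ := Nat.find_spec hex
      set c := Nat.find hex
      have hno : ∀ j, a ≤ j → j < c → ¬ J j b := fun j haj hjc hj =>
        Nat.find_min hex hjc ⟨haj, hjc.trans hcb, hj⟩
      cases h with
      | zero =>
        rw [Finset.filter_false_of_mem]
        · simp
        · intro j hj hr
          exact absurd hr (not_le.mpr (Finset.mem_Ico.mp hj).2)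
      | succ h =>
        cases k with
        | zero =>
          have h0 := hdepth b (hac.trans_lt hcb) le_rfl
          have hmem : c ∈ (Finset.Ico a b).filter fun τ => J τ b := by
            simp [hac, hcb, hJc]
          have := Finset.card_pos.mpr ⟨c, hmem⟩
          omega
        | succ k =>
          have h1 := ih h (k + 1) a c (by omega)
            (fun s has hsc => hdepth s has (hsc.trans hcb.le))
          have h2 := ih (h + 1) k (c + 1) b (by omega) (by
            intro s hcs hsb
            have hc : c ∉ (Finset.Ico (c + 1) s).filter fun τ => J τ s := by simp
            have hsub : insert c ((Finset.Ico (c + 1) s).filter fun τ => J τ s) ⊆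
                (Finset.Ico a s).filter fun τ => J τ s := by
              intro x hx
              simp only [Finset.mem_insert, Finset.mem_filter, Finset.mem_Ico] at hx ⊢
              rcases hx with rfl | ⟨⟨h₁, h₂⟩, h₃⟩
              · exact ⟨⟨hac, by omega⟩, hJ _ _ _ hJc (by omega) hsb⟩
              · exact ⟨⟨by omega, h₂⟩, h₃⟩
            have h₃ := Finset.card_le_card hsub
            rw [Finset.card_insert_of_notMem hc] at h₃
            have h₄ := hdepth s (by omega) hsb
            omega)
          have hsub : ((Finset.Ico a b).filter fun j => Reach J b (h + 1) j) ⊆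
              insert c (((Finset.Ico a c).filter fun j => Reach J c h j) ∪
                ((Finset.Ico (c + 1) b).filter fun j => Reach J b (h + 1) j)) := by
            intro x hx
            simp only [Finset.mem_insert, Finset.mem_union, Finset.mem_filter,
              Finset.mem_Ico] at hx ⊢
            obtain ⟨⟨hax, hxb⟩, hr⟩ := hx
            rcases lt_trichotomy x c with hxc | hxc | hxc
            · exact Or.inr (Or.inl ⟨⟨hax, hxc⟩, Reach.pred hJ hcb.le hno h x hax hxc hr⟩)
            · exact Or.inl hxc
            · exact Or.inr (Or.inr ⟨⟨hxc, hxb⟩, hr⟩)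
          have h3 := (Finset.card_le_card hsub).trans (Finset.card_insert_le _ _)
          have h4 := Finset.card_union_le ((Finset.Ico a c).filter fun j => Reach J c h j)
            ((Finset.Ico (c + 1) b).filter fun j => Reach J b (h + 1) j)
          have h5 : (k + 1 + (h + 1)).choose (h + 1) =
              (k + 1 + h).choose h + (k + (h + 1)).choose (h + 1) := by
            rw [show k + 1 + (h + 1) = (k + 1 + h) + 1 by ring, Nat.choose_succ_succ,
              show k + (h + 1) = k + 1 + h by ring]
          omega
    · rw [Finset.filter_false_of_mem]
      · simpa using Nat.succ_le_of_lt (Nat.choose_pos (Nat.le_add_left h k))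
      · intro j hj hr
        obtain ⟨haj, hjb⟩ := Finset.mem_Ico.mp hj
        obtain ⟨c, h₁, h₂, h₃⟩ := Reach.exists_jump hJ h j hjb hr
        exact hex ⟨c, haj.trans h₁, h₂, h₃⟩

open Classical in
/-- The number of jumps needed to get from `j` to `b`, truncated at `H`. -/
noncomputable def jumpDist (J : ℕ → ℕ → Prop) (b H j : ℕ) : ℕ :=
  ((Finset.range H).filter fun h => ¬ Reach J b h j).card

theorem jumpDist_eq_zero {J : ℕ → ℕ → Prop} {b j : ℕ} (hj : b ≤ j) (H : ℕ) :
    jumpDist J b H j = 0 := by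
  classical
  rw [jumpDist, Finset.card_eq_zero, Finset.filter_false_of_mem]
  intro h _ hr
  exact hr (Reach.of_le hj h)

theorem jumpDist_le_succ {J : ℕ → ℕ → Prop} {b τ s : ℕ} (hτ : τ < s) (hJ : J τ s) (H : ℕ) :
    jumpDist J b H τ ≤ jumpDist J b H s + 1 := by
  classical
  have hsub : ((Finset.range H).filter fun h => ¬ Reach J b h τ) ⊆
      insert 0 (((Finset.range H).filter fun h => ¬ Reach J b h s).image Nat.succ) := by
    intro h hh
    simp only [Finset.mem_filter, Finset.mem_range, Finset.mem_insert, Finset.mem_image] at hh ⊢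
    cases h with
    | zero => exact Or.inl rfl
    | succ h =>
      refine Or.inr ⟨h, ⟨by omega, fun hr => hh.2 (Or.inr ⟨s, hτ, hJ, hr⟩)⟩, rfl⟩
  calc jumpDist J b H τ ≤ _ := Finset.card_le_card hsub
    _ ≤ _ := Finset.card_insert_le _ _
    _ ≤ _ := Nat.add_le_add_right Finset.card_image_le 1

/-- If at most `t` positions jump across each point, most positions are far from the end. -/
theorem mul_le_sum_jumpDist {J : ℕ → ℕ → Prop}
    (hJ : ∀ τ s s', J τ s → τ < s' → s' ≤ s → J τ s') {n t : ℕ}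
    (hdepth : ∀ s (S : Finset ℕ), (∀ τ ∈ S, J τ s) → S.card ≤ t) (H : ℕ) :
    H * n ≤ ∑ k ∈ Finset.range n, jumpDist J (n + 1) H (k + 1) + H * (t + H).choose H := by
  classical
  have hcard : ∀ h < H, n ≤ ((Finset.Ico 1 (n + 1)).filter fun j => ¬ Reach J (n + 1) h j).card +
      (t + H).choose H := by
    intro h hh
    have h1 := card_reach_lt_choose hJ (h + t) h t 1 (n + 1) rfl
      (fun s _ _ => hdepth s _ (fun τ hτ => (Finset.mem_filter.mp hτ).2))
    have h2 := Finset.card_filter_add_card_filter_not (s := Finset.Ico 1 (n + 1))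
      (fun j => Reach J (n + 1) h j)
    have h3 : (t + h).choose h ≤ (t + H).choose H := by
      rw [← Nat.choose_symm_add, ← Nat.choose_symm_add]
      exact Nat.choose_le_choose t (by omega)
    rw [Nat.card_Ico] at h2
    omega
  have hsum : ∑ k ∈ Finset.range n, jumpDist J (n + 1) H (k + 1) =
      ∑ h ∈ Finset.range H,
        ((Finset.Ico 1 (n + 1)).filter fun j => ¬ Reach J (n + 1) h j).card := by
    have h1 : ∑ k ∈ Finset.range n, jumpDist J (n + 1) H (k + 1) =
        ∑ j ∈ Finset.Ico 1 (n + 1), jumpDist J (n + 1) H j := by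
      rw [Finset.sum_Ico_eq_sum_range]
      simp [add_comm]
    rw [h1]
    simp only [jumpDist, Finset.card_filter]
    exact Finset.sum_comm
  rw [hsum]
  calc H * n = ∑ h ∈ Finset.range H, n := by simp
    _ ≤ ∑ h ∈ Finset.range H,
        (((Finset.Ico 1 (n + 1)).filter fun j => ¬ Reach J (n + 1) h j).card +
          (t + H).choose H) :=
      Finset.sum_le_sum fun h hh => hcard h (Finset.mem_range.mp hh)
    _ = _ := by rw [Finset.sum_add_distrib]; simp

/-- The last time at most `k` at which bin `i` was empty or selected for a shuffle. -/
def lastTouch {t : ℕ} (b : ℕ → Fin t → ℕ) (I : ℕ → Finset (Fin t)) : ℕ → Fin t → ℕ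
  | 0, _ => 0
  | k + 1, i => if i ∈ I k ∨ b k i = 0 then k + 1 else lastTouch b I k i

theorem lastTouch_le {t : ℕ} (b : ℕ → Fin t → ℕ) (I : ℕ → Finset (Fin t)) (k : ℕ) (i : Fin t) :
    lastTouch b I k i ≤ k := by
  induction k with
  | zero => exact le_rfl
  | succ k ih =>
    rw [lastTouch]
    split_ifs <;> omega

theorem lastTouch_eq_of_le {t : ℕ} {b : ℕ → Fin t → ℕ} {I : ℕ → Finset (Fin t)} {k l : ℕ}
    {i : Fin t} (hl : lastTouch b I k i ≤ l) (hlk : l ≤ k) :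
    lastTouch b I l i = lastTouch b I k i := by
  induction k with
  | zero => rw [Nat.le_zero.mp hlk]
  | succ k ih =>
    rcases hlk.eq_or_lt with rfl | hlt
    · rfl
    · rw [lastTouch] at hl ⊢
      split_ifs at hl ⊢ with hc
      · omega
      · exact ih hl (by omega)

/-- Every run costs at least `H * (n - (t + H).choose H)`. -/
theorem IsRun.mul_le_cost {t n : ℕ} {b : ℕ → Fin t → ℕ} {c : ℕ → ℕ} (hrun : IsRun t n b c)
    (H : ℕ) : H * n ≤ ∑ k ∈ Finset.range n, c k + H * (t + H).choose H := by
  classical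
  obtain ⟨hb0, hstep⟩ := hrun
  have hstep' : ∀ k, ∃ I : Finset (Fin t), k < n → c k = (∑ i ∈ I, b k i) + 1 ∧
      (∀ i, i ∉ I → b k i ≠ 0 → b (k + 1) i = b k i) ∧
      (∑ i, b (k + 1) i) = (∑ i, b k i) + 1 := by
    intro k
    by_cases hk : k < n
    · obtain ⟨I, hI⟩ := hstep k hk
      exact ⟨I, fun _ => hI⟩
    · exact ⟨∅, fun h => absurd h hk⟩
  choose I hI using hstep'
  set J : ℕ → ℕ → Prop := fun τ s => ∃ i, lastTouch b I (s - 1) i = τ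
  have hJ : ∀ τ s s', J τ s → τ < s' → s' ≤ s → J τ s' := by
    rintro τ s s' ⟨i, rfl⟩ hs' hs
    exact ⟨i, lastTouch_eq_of_le (by omega) (by omega)⟩
  have hdepth : ∀ s (S : Finset ℕ), (∀ τ ∈ S, J τ s) → S.card ≤ t := by
    intro s S hS
    have hsub : S ⊆ Finset.univ.image (lastTouch b I (s - 1)) := by
      intro τ hτ
      obtain ⟨i, hi⟩ := hS τ hτ
      exact Finset.mem_image.mpr ⟨i, Finset.mem_univ i, hi⟩
    calc S.card ≤ _ := Finset.card_le_card hsub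
      _ ≤ _ := Finset.card_image_le
      _ = t := by simp
  set D := jumpDist J (n + 1) H with hD
  have hjump : ∀ k i, D (lastTouch b I k i) ≤ D (k + 1) + 1 := fun k i =>
    jumpDist_le_succ (Nat.lt_succ_of_le (lastTouch_le b I k i)) ⟨i, rfl⟩ H
  set W : ℕ → ℕ := fun k => ∑ i, b k i * D (lastTouch b I k i) with hW
  have htotal : ∀ k, k ≤ n → ∑ i, b k i = k := by
    intro k
    induction k with
    | zero => simp [hb0]
    | succ k ih =>
      intro hk
      rw [(hI k hk).2.2, ih (by omega)]
  have hpot : ∀ k, k < n → W k + D (k + 1) + 1 ≤ W (k + 1) + c k := by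
    intro k hk
    obtain ⟨hc, hkeep, hsum⟩ := hI k hk
    set A : Finset (Fin t) := Finset.univ.filter fun i => i ∈ I k ∨ b k i = 0 with hA
    have hIA : ∀ f : Fin t → ℕ, ∑ i ∈ A, b k i * f i = ∑ i ∈ I k, b k i * f i := by
      intro f
      symm
      apply Finset.sum_subset
      · intro i hi
        simp [hA, hi]
      · intro i hi hi'
        have : b k i = 0 := by simpa [hA, hi'] using hi
        simp [this]
    have hIA1 : ∑ i ∈ A, b k i = ∑ i ∈ I k, b k i := by simpa using hIA fun _ => 1
    have hkeepA : ∀ i ∈ Aᶜ, b (k + 1) i = b k i ∧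
        lastTouch b I (k + 1) i = lastTouch b I k i := by
      intro i hi
      have hi' : ¬ (i ∈ I k ∨ b k i = 0) := by simpa [hA] using hi
      refine ⟨hkeep i (fun h => hi' (Or.inl h)) (fun h => hi' (Or.inr h)), ?_⟩
      rw [lastTouch, if_neg hi']
    have hnewA : ∀ i ∈ A, lastTouch b I (k + 1) i = k + 1 := by
      intro i hi
      rw [lastTouch, if_pos (by simpa [hA] using hi)]
    have hW1 : W k = ∑ i ∈ A, b k i * D (lastTouch b I k i) +
        ∑ i ∈ Aᶜ, b k i * D (lastTouch b I k i) := (Finset.sum_add_sum_compl A _).symm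
    have hW2 : W (k + 1) = (∑ i ∈ A, b (k + 1) i) * D (k + 1) +
        ∑ i ∈ Aᶜ, b k i * D (lastTouch b I k i) := by
      simp only [hW]
      rw [← Finset.sum_add_sum_compl A, Finset.sum_mul]
      congr 1
      · exact Finset.sum_congr rfl fun i hi => by rw [hnewA i hi]
      · exact Finset.sum_congr rfl fun i hi => by rw [(hkeepA i hi).1, (hkeepA i hi).2]
    have hAc : ∑ i ∈ A, b (k + 1) i = c k := by
      have h1 := Finset.sum_add_sum_compl A (b (k + 1))
      have h2 := Finset.sum_add_sum_compl A (b k)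
      have h3 : ∑ i ∈ Aᶜ, b (k + 1) i = ∑ i ∈ Aᶜ, b k i :=
        Finset.sum_congr rfl fun i hi => (hkeepA i hi).1
      omega
    have hWA : ∑ i ∈ A, b k i * D (lastTouch b I k i) ≤
        (∑ i ∈ I k, b k i) * (D (k + 1) + 1) := by
      rw [← hIA1, Finset.sum_mul]
      exact Finset.sum_le_sum fun i _ => Nat.mul_le_mul_left _ (hjump k i)
    rw [hW1, hW2, hAc, hc]
    linarith
  have hacc : ∀ m, m ≤ n → ∑ k ∈ Finset.range m, D (k + 1) + m ≤
      W m + ∑ k ∈ Finset.range m, c k := by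
    intro m
    induction m with
    | zero => simp
    | succ m ih =>
      intro hm
      have h1 := ih (by omega)
      have h2 := hpot m hm
      rw [Finset.sum_range_succ, Finset.sum_range_succ]
      omega
  have hWn : W n ≤ n := by
    have hDn : D (n + 1) = 0 := jumpDist_eq_zero le_rfl H
    calc W n ≤ ∑ i, b n i * 1 := Finset.sum_le_sum fun i _ =>
          Nat.mul_le_mul_left _ (by simpa [hDn] using hjump n i)
      _ = n := by simpa using htotal n le_rfl
  have h1 := hacc n le_rfl
  have h2 := mul_le_sum_jumpDist hJ (n := n) hdepth H
  rw [← hD] at h2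
  omega

theorem exists_isRun {t : ℕ} (ht : 1 ≤ t) (n : ℕ) : ∃ b c, IsRun t n b c := by
  refine ⟨fun k i => if i = ⟨0, ht⟩ then k else 0, fun k => k + 1, ?_, ?_⟩
  · intro i
    simp
  · intro k _
    refine ⟨Finset.univ, ?_, ?_, ?_⟩ <;> simp

theorem mul_le_shuffleCost {t : ℕ} (ht : 1 ≤ t) (n H : ℕ) :
    H * n ≤ shuffleCost t n + H * (t + H).choose H := by
  have hne : { s | ∃ b c, IsRun t n b c ∧ s = ∑ k ∈ Finset.range n, c k }.Nonempty := by
    obtain ⟨b, c, h⟩ := exists_isRun ht n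
    exact ⟨_, b, c, h, rfl⟩
  obtain ⟨b, c, hrun, hs⟩ := Nat.sInf_mem hne
  rw [shuffleCost, hs]
  exact hrun.mul_le_cost H

theorem Nat.cast_choose_add_le_exp_pow {t : ℕ} (ht : 1 ≤ t) (H : ℕ) :
    ((t + H).choose H : ℝ) ≤ (Real.exp 1 * (1 + H / t)) ^ t := by
  have ht' : (0 : ℝ) < t := by exact_mod_cast ht
  rw [← Nat.choose_symm_add]
  calc ((t + H).choose t : ℝ) ≤ ((t + H : ℕ) : ℝ) ^ t / (t.factorial : ℝ) :=
        Nat.choose_le_pow_div t (t + H)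
    _ = (1 + H / t : ℝ) ^ t * ((t : ℝ) ^ t / (t.factorial : ℝ)) := by
        rw [← mul_div_assoc, ← mul_pow]
        congr 2
        push_cast
        field_simp
    _ ≤ (1 + H / t : ℝ) ^ t * Real.exp t := by
        gcongr
        exact Real.pow_div_factorial_le_exp t ht'.le t
    _ = _ := by
        rw [mul_pow, ← Real.exp_nat_mul, mul_one, mul_comm]

/-- Phase one of the ball-shuffling lower bound: there exist constants
c₀, c₁, c₂ > 0 such that for all n ≥ 2 and all t with 1 ≤ t ≤ ⌊c₀·ln n⌋,
f_t(n) ≥ c₁·t·n^{1+c₂/t} − 2tn. -/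
theorem ball_shuffling_phase_one :
    ∃ c₀ c₁ c₂ : ℝ, 0 < c₀ ∧ 0 < c₁ ∧ 0 < c₂ ∧
      ∀ n t : ℕ, 2 ≤ n → 1 ≤ t → (t : ℤ) ≤ ⌊c₀ * Real.log n⌋ →
        (shuffleCost t n : ℝ) ≥
          c₁ * (t : ℝ) * (n : ℝ) ^ (1 + c₂ / (t : ℝ)) - 2 * (t : ℝ) * (n : ℝ) := by
  refine ⟨1 / 3, 1 / 24, 1, by norm_num, by norm_num, by norm_num, ?_⟩
  intro n t hn ht htn
  have ht' : (1 : ℝ) ≤ t := by exact_mod_cast ht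
  have hn' : (0 : ℝ) < n := by positivity
  have hlog : (t : ℝ) ≤ 1 / 3 * Real.log n := by
    have := Int.le_floor.mp htn
    exact_mod_cast this
  obtain ⟨x, hx⟩ : ∃ x : ℝ, x = (n : ℝ) ^ (1 / (t : ℝ)) := ⟨_, rfl⟩
  have hxt : x ^ t = n := by
    rw [hx, one_div, Real.rpow_inv_natCast_pow hn'.le (by omega)]
  have he := Real.exp_one_gt_d9
  have he' := Real.exp_one_lt_d9
  have hx12 : 12 ≤ x := by
    have h1 : Real.exp 3 ≤ x := by
      rw [hx, Real.rpow_def_of_pos hn']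
      apply Real.exp_le_exp.mpr
      rw [mul_one_div, le_div_iff₀ (by linarith)]
      linarith
    have h2 : Real.exp 3 = Real.exp 1 ^ 3 := by
      rw [← Real.exp_nat_mul]
      norm_num
    have h3 : (2.7 : ℝ) ^ 3 ≤ Real.exp 1 ^ 3 := by
      gcongr
      linarith
    norm_num at h3
    linarith
  obtain ⟨H, hH⟩ : ∃ H : ℕ, H = ⌊(t : ℝ) * x / 12⌋₊ := ⟨_, rfl⟩
  have hH1 : (H : ℝ) ≤ t * x / 12 := hH ▸ Nat.floor_le (by positivity)
  have hH2 : (t : ℝ) * x / 12 < H + 1 := hH ▸ Nat.lt_floor_add_one _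
  have hchoose : ((t + H).choose H : ℝ) ≤ n / 2 := by
    refine (Nat.cast_choose_add_le_exp_pow ht H).trans ?_
    have h1 : (H : ℝ) / t ≤ x / 12 := by
      rw [div_le_iff₀ (by linarith)]
      linarith
    have h2 : Real.exp 1 * (1 + H / t) ≤ x / 2 := by
      calc Real.exp 1 * (1 + H / t) ≤ 3 * (1 + x / 12) := by
            gcongr
            linarith
        _ ≤ x / 2 := by linarith
    calc (Real.exp 1 * (1 + H / t)) ^ t ≤ (x / 2) ^ t := by gcongr
      _ = n / 2 ^ t := by rw [div_pow, hxt]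
      _ ≤ n / 2 := by
        gcongr
        calc (2 : ℝ) = 2 ^ 1 := by norm_num
          _ ≤ 2 ^ t := by gcongr; norm_num
  have hmain : (H : ℝ) * n ≤ shuffleCost t n + H * (t + H).choose H := by
    exact_mod_cast mul_le_shuffleCost ht n H
  have hpow : (n : ℝ) ^ (1 + 1 / (t : ℝ)) = n * x := by
    rw [Real.rpow_add hn', Real.rpow_one, hx]
  rw [hpow]
  have h1 : (H : ℝ) * (t + H).choose H ≤ H * (n / 2) := by gcongr
  have h2 : (t : ℝ) * x / 12 * n ≤ (H + 1) * n := by gcongr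
  have h3 : (n : ℝ) ≤ t * n := le_mul_of_one_le_left hn'.le ht'
  linarith
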